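/- arXiv:1806.10838 — 2 statements merged into one kernel-verified Lean document; each statement's English description precedes it below -/
import Mathlib

section
/- Let n ≥ 2 and let ν_x, ν_z ∈ ℝⁿ be unit vectors. Then there exist orthogonal matrices P_{ν_x}, P_{ν_z} ∈ O(n) with P_{ν_x}e₁ = ν_x and P_{ν_z}e₁ = ν_z such that |P_{ν_x}ζ − P_{ν_z}ζ| ≤ |ν_x + ν_z| for every ζ ∈ ℝⁿ with |ζ| ≤ 1 and ⟨e₁, ζ⟩ = 0. -/
open scoped RealInnerProductSpace

noncomputable section

/-- First standard basis vector of `ℝⁿ`. -/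
def e1 (n : ℕ) (hn : 0 < n) : EuclideanSpace ℝ (Fin n) := EuclideanSpace.single ⟨0, hn⟩ 1

/-- Action of an `n × n` matrix on Euclidean space. -/
def mact {n : ℕ} (P : Matrix (Fin n) (Fin n) ℝ) (ζ : EuclideanSpace ℝ (Fin n)) :
    EuclideanSpace ℝ (Fin n) :=
  Matrix.toEuclideanLin P ζ

end

theorem exists_matrix_of_isometry {n : ℕ}
    (e : EuclideanSpace ℝ (Fin n) ≃ₗᵢ[ℝ] EuclideanSpace ℝ (Fin n)) :
    ∃ P : Matrix (Fin n) (Fin n) ℝ, P ∈ Matrix.orthogonalGroup (Fin n) ℝ ∧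
      ∀ x, mact P x = e x := by
  let u := Unitary.linearIsometryEquiv.symm e
  let T := Matrix.toEuclideanCLM (n := Fin n) (𝕜 := ℝ)
  refine ⟨T.symm u.1, ?_, fun x => ?_⟩
  · exact Unitary.map_mem T.symm u.2
  · have h : T (T.symm u.1) = u.1 := T.apply_symm_apply _
    have h2 : T (T.symm u.1) x = e x := by rw [h]; rfl
    exact h2

theorem reflection_bound {E : Type*} [NormedAddCommGroup E] [InnerProductSpace ℝ E]
    (a b y : E) (ha : ‖a‖ = 1) (hb : ‖b‖ = 1) (hy : ‖y‖ ≤ 1) (hay : ⟪a, y⟫ = 0) :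
    ‖y - (ℝ ∙ (a - b))ᗮ.reflection y‖ ≤ ‖a + b‖ := by
  have hcs := abs_real_inner_le_norm (b - ⟪a, b⟫ • a) y
  have h1 : ⟪b - ⟪a, b⟫ • a, y⟫ = ⟪b, y⟫ := by
    rw [inner_sub_left, real_inner_smul_left, hay]; ring
  have h2 : ‖b - ⟪a, b⟫ • a‖ ^ 2 = 1 - ⟪a, b⟫ ^ 2 := by
    rw [norm_sub_sq_real, norm_smul, real_inner_smul_right, real_inner_comm, ha, hb,
      Real.norm_eq_abs, mul_one, sq_abs]
    ring
  have h3 : ⟪b, y⟫ ^ 2 ≤ 1 - ⟪a, b⟫ ^ 2 := by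
    rw [h1] at hcs
    rw [← h2, ← sq_abs]
    have : |⟪b, y⟫| ≤ ‖b - ⟪a, b⟫ • a‖ :=
      hcs.trans (mul_le_of_le_one_right (norm_nonneg _) hy)
    gcongr
  have hp : ‖a + b‖ ^ 2 = 2 + 2 * ⟪a, b⟫ := by
    rw [norm_add_sq_real, ha, hb]; ring
  have hm : ‖a - b‖ ^ 2 = 2 - 2 * ⟪a, b⟫ := by
    rw [norm_sub_sq_real, ha, hb]; ring
  have hin : ⟪a - b, y⟫ = -⟪b, y⟫ := by rw [inner_sub_left, hay]; ring
  have hr : y - (ℝ ∙ (a - b))ᗮ.reflection y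
      = (2 * (⟪a - b, y⟫ / ‖a - b‖ ^ 2)) • (a - b) := by
    rw [Submodule.reflection_orthogonal_apply, Submodule.reflection_singleton_apply]
    simp [two_smul, two_mul, add_smul]
  rw [hr, norm_smul, hin]
  rcases eq_or_lt_of_le (norm_nonneg (a - b)) with h0 | h0
  · rw [← h0]; simp
  · apply abs_le_of_sq_le_sq' _ (norm_nonneg _) |>.2
    rw [mul_pow, Real.norm_eq_abs, sq_abs]
    have : (2 * (-⟪b, y⟫ / ‖a - b‖ ^ 2)) ^ 2 * ‖a - b‖ ^ 2
        = 4 * ⟪b, y⟫ ^ 2 / ‖a - b‖ ^ 2 := by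
      field_simp; ring
    rw [this, div_le_iff₀ (by positivity), hp, hm]
    nlinarith

theorem exists_orthogonal_transformations
    {n : ℕ} (hn : 2 ≤ n) (νx νz : EuclideanSpace ℝ (Fin n))
    (hνx : ‖νx‖ = 1) (hνz : ‖νz‖ = 1) :
    ∃ P Q : Matrix (Fin n) (Fin n) ℝ,
      P ∈ Matrix.orthogonalGroup (Fin n) ℝ ∧ Q ∈ Matrix.orthogonalGroup (Fin n) ℝ ∧
      mact P (e1 n (by omega)) = νx ∧ mact Q (e1 n (by omega)) = νz ∧
      ∀ ζ : EuclideanSpace ℝ (Fin n), ‖ζ‖ ≤ 1 → ⟪e1 n (by omega), ζ⟫ = 0 →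
        ‖mact P ζ - mact Q ζ‖ ≤ ‖νx + νz‖ := by
  have he : ‖e1 n (by omega)‖ = 1 := by simp [e1]
  let R := (ℝ ∙ (e1 n (by omega) - νx))ᗮ.reflection
  let S := (ℝ ∙ (νx - νz))ᗮ.reflection
  have hR : R (e1 n (by omega)) = νx := Submodule.reflection_sub (he.trans hνx.symm)
  have hS : S νx = νz := Submodule.reflection_sub (hνx.trans hνz.symm)
  obtain ⟨P, hP, hP'⟩ := exists_matrix_of_isometry R
  obtain ⟨Q, hQ, hQ'⟩ := exists_matrix_of_isometry (R.trans S)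
  refine ⟨P, Q, hP, hQ, by rw [hP', hR], ?_, fun ζ hζ h => ?_⟩
  · rw [hQ', LinearIsometryEquiv.trans_apply, hR, hS]
  · rw [hP', hQ', LinearIsometryEquiv.trans_apply]
    refine reflection_bound νx νz (R ζ) hνx hνz ?_ ?_
    · rwa [LinearIsometryEquiv.norm_map]
    · rw [← hR, LinearIsometryEquiv.inner_map_map, h]
end

section
/- Let n ≥ 2, s ∈ (0,1), γ := 1+s, α_min ∈ (0,1], C_α > 0, M > 0, let ω₀ ≥ max{1/2, (C_α+2)/(3α_min·s(1+s))}, let C > 2(4M+1), and let N ∈ ℕ satisfy N ≥ 40 and N > 2^{11/2}·10·Cω₀. Let ε > 0 and x, z ∈ ℝⁿ with Nε/10 < |x−z| ≤ ω₁ := (1/(2γω₀))^{1/(γ−1)}, set v := (x−z)/|x−z|, ω(t) := t − ω₀t^γ, f₁(x,z) := Cω(|x−z|) + M|x+z|². Let a, b ∈ ℝ with α_min ≤ b ≤ a ≤ 1 and a − b ≤ C_α|x−z|^s. Let ν_x, ν_z ∈ ℝⁿ be unit vectors with ⟨v, ν_x − ν_z⟩² ≥ 4 − |x−z|^s. Then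 there exist P₁, P₂, P₃, P₄ ∈ O(n) with P₁e₁ = ν_x, P₂e₁ = ν_z, P₃e₁ = −ν_x, P₄e₁ = −ν_z such that, writing F(ν, μ; P, Q) := b·f₁(x+εν, z+εμ) + (1−a)·⨍_{B^{e₁}} f₁(x+εPζ, z+εQζ) dμ^{n−1}(ζ) + (a−b)·⨍_{B^{e₁}} f₁(x+εν, z+εQζ) dμ^{n−1}(ζ), one has F(ν_x, ν_z; P₁, P₂) + F(−ν_x, −ν_z; P₃, P₄) − 2f₁(x,z) ≤ (2(4M+1) − C)·|x−z|^{s−1}·ε² < 0. -/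
open MeasureTheory Metric
open scoped ENNReal RealInnerProductSpace

noncomputable section

/-- The set `B^{e₁} = {ζ : ‖ζ‖ < 1, ζ₁ = 0}`. -/
def unitSlice (n : ℕ) (hn : 0 < n) : Set (EuclideanSpace ℝ (Fin n)) :=
  {ζ | ‖ζ‖ < 1 ∧ ⟪e1 n hn, ζ⟫ = 0}

end
theorem aux_bern (p u : ℝ) (hp : p ≤ 0) (hu : 0 < 1 + u) : 1 + p * u ≤ (1 + u) ^ p := by
  rw [Real.rpow_def_of_pos hu]
  have h1 := Real.add_one_le_exp (Real.log (1 + u) * p)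
  have h2 := Real.log_le_sub_one_of_pos hu
  nlinarith

theorem aux_step1 (s : ℝ) (hs0 : 0 < s) (hs1 : s < 1) (t : ℝ) (ht0 : 0 ≤ t) (ht1 : t < 1) :
    2 * s * t ≤ (1 + t) ^ s - (1 - t) ^ s := by
  have hd : ∀ u ∈ Set.Ico (0:ℝ) 1, HasDerivAt (fun u : ℝ => (1 + u) ^ s - (1 - u) ^ s - 2 * s * u)
      (s * (1 + u) ^ (s - 1) + s * (1 - u) ^ (s - 1) - 2 * s) u := by
    intro u hu
    have h1 : HasDerivAt (fun u : ℝ => (1 + u) ^ s) (1 * s * (1 + u) ^ (s - 1)) u :=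
      ((hasDerivAt_id u).const_add 1).rpow_const (Or.inl (by simp; linarith [hu.1]))
    have h2 : HasDerivAt (fun u : ℝ => (1 - u) ^ s) (-1 * s * (1 - u) ^ (s - 1)) u :=
      ((hasDerivAt_id u).const_sub 1).rpow_const (Or.inl (by simp; linarith [hu.2]))
    have h3 := (h1.sub h2).sub ((hasDerivAt_id u).const_mul (2 * s))
    refine h3.congr_deriv ?_
    ring
  have hm : MonotoneOn (fun u : ℝ => (1 + u) ^ s - (1 - u) ^ s - 2 * s * u) (Set.Ico 0 1) := by
    apply monotoneOn_of_deriv_nonneg (convex_Ico 0 1)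
    · exact fun u hu => (hd u hu).continuousAt.continuousWithinAt
    · exact fun u hu => (hd u (interior_subset hu)).differentiableAt.differentiableWithinAt
    · intro u hu
      have hu' := interior_subset hu
      rw [(hd u hu').deriv]
      have h1 := aux_bern (s - 1) u (by linarith) (by linarith [hu'.1])
      have h2 := aux_bern (s - 1) (-u) (by linarith) (by linarith [hu'.2])
      rw [← sub_eq_add_neg] at h2
      nlinarith
  have := hm (show (0:ℝ) ∈ Set.Ico (0:ℝ) 1 by simp) (show t ∈ Set.Ico (0:ℝ) 1 from ⟨ht0, ht1⟩) ht0
  simp at this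
  linarith

theorem aux_step2 (s : ℝ) (hs0 : 0 < s) (hs1 : s < 1) (t : ℝ) (ht0 : 0 ≤ t) (ht1 : t < 1) :
    2 + (1 + s) * s * t ^ 2 ≤ (1 + t) ^ (1 + s) + (1 - t) ^ (1 + s) := by
  have hd : ∀ u ∈ Set.Ico (0:ℝ) 1, HasDerivAt
      (fun u : ℝ => (1 + u) ^ (1 + s) + (1 - u) ^ (1 + s) - (1 + s) * s * u ^ 2)
      ((1 + s) * ((1 + u) ^ s - (1 - u) ^ s - 2 * s * u)) u := by
    intro u hu
    have h1 : HasDerivAt (fun u : ℝ => (1 + u) ^ (1 + s)) (1 * (1 + s) * (1 + u) ^ (1 + s - 1)) u :=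
      ((hasDerivAt_id u).const_add 1).rpow_const (Or.inl (by simp; linarith [hu.1]))
    have h2 : HasDerivAt (fun u : ℝ => (1 - u) ^ (1 + s)) (-1 * (1 + s) * (1 - u) ^ (1 + s - 1)) u :=
      ((hasDerivAt_id u).const_sub 1).rpow_const (Or.inl (by simp; linarith [hu.2]))
    have h3 := (h1.add h2).sub ((hasDerivAt_pow 2 u).const_mul ((1 + s) * s))
    refine h3.congr_deriv ?_
    rw [add_sub_cancel_left]
    push_cast
    ring
  have hm : MonotoneOn (fun u : ℝ => (1 + u) ^ (1 + s) + (1 - u) ^ (1 + s) - (1 + s) * s * u ^ 2)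
      (Set.Ico 0 1) := by
    apply monotoneOn_of_deriv_nonneg (convex_Ico 0 1)
    · exact fun u hu => (hd u hu).continuousAt.continuousWithinAt
    · exact fun u hu => (hd u (interior_subset hu)).differentiableAt.differentiableWithinAt
    · intro u hu
      have hu' := interior_subset hu
      rw [(hd u hu').deriv]
      have h1 := aux_step1 s hs0 hs1 u hu'.1 hu'.2
      apply mul_nonneg <;> linarith
  have := hm (show (0:ℝ) ∈ Set.Ico (0:ℝ) 1 by simp) (show t ∈ Set.Ico (0:ℝ) 1 from ⟨ht0, ht1⟩) ht0
  norm_num at this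
  linarith

theorem aux_step3 (s : ℝ) (hs0 : 0 < s) (hs1 : s < 1) (t : ℝ) (ht1 : |t| < 1) :
    2 + (1 + s) * s * t ^ 2 ≤ (1 + t) ^ (1 + s) + (1 - t) ^ (1 + s) := by
  have h := aux_step2 s hs0 hs1 |t| (abs_nonneg t) ht1
  rcases abs_cases t with ⟨h1, _⟩ | ⟨h1, _⟩
  · rwa [h1] at h
  · rw [h1] at h
    have e : 1 - -t = 1 + t := by ring
    rw [e, ← sub_eq_add_neg] at h
    nlinarith

theorem aux_pow (s : ℝ) (hs0 : 0 < s) (hs1 : s < 1) (r t : ℝ) (hr : 0 < r) (ht : |t| < r) :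
    2 * r ^ (1 + s) + (1 + s) * s * t ^ 2 * r ^ (s - 1) ≤ (r + t) ^ (1 + s) + (r - t) ^ (1 + s) := by
  have h := aux_step3 s hs0 hs1 (t / r) (by rw [abs_div, abs_of_pos hr, div_lt_one hr]; exact ht)
  obtain ⟨hl, hu⟩ := abs_lt.1 ht
  have e1 : (r + t) = r * (1 + t / r) := by field_simp
  have e2 : (r - t) = r * (1 - t / r) := by field_simp
  have p1 : 0 ≤ 1 + t / r := by
    by_contra hc; push Not at hc; nlinarith
  have p2 : 0 ≤ 1 - t / r := by
    by_contra hc; push Not at hc; nlinarith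
  rw [e1, e2, Real.mul_rpow hr.le p1, Real.mul_rpow hr.le p2]
  have e3 : r ^ (1 + s) = r ^ (s - 1) * r ^ 2 := by
    rw [← Real.rpow_natCast, ← Real.rpow_add hr]; norm_num; ring_nf
  have hp : 0 < r ^ (1 + s) := Real.rpow_pos_of_pos hr _
  have e4 : (1 + s) * s * t ^ 2 * r ^ (s - 1) = r ^ (1 + s) * ((1 + s) * s * (t / r) ^ 2) := by
    rw [e3]; field_simp
  rw [e4]
  nlinarith

/-- Key pairing estimate in an inner product space. -/
theorem aux_pair {E : Type*} [NormedAddCommGroup E] [InnerProductSpace ℝ E]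
    (s : ℝ) (hs0 : 0 < s) (hs1 : s < 1) (v η : E) (r ε : ℝ) (hv : ‖v‖ = 1) (hη : ‖η‖ ≤ 2)
    (hε : 0 < ε) (hr : 2 * ε < r) :
    (‖r • v + ε • η‖ + ‖r • v - ε • η‖ ≤
      2 * r + ε ^ 2 * (‖η‖ ^ 2 - ⟪v, η⟫ ^ 2) / (r - 2 * ε)) ∧
    (2 * r ^ (1 + s) + (1 + s) * s * (ε ^ 2 * ⟪v, η⟫ ^ 2) * r ^ (s - 1) ≤
      ‖r • v + ε • η‖ ^ (1 + s) + ‖r • v - ε • η‖ ^ (1 + s)) := by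
  set m := ⟪v, η⟫ with hm
  have hmab : |m| ≤ 2 := by
    have := abs_real_inner_le_norm v η
    rw [hv, one_mul] at this; linarith
  obtain ⟨hm1, hm2⟩ := abs_le.1 hmab
  have hperp : 0 ≤ ‖η‖ ^ 2 - m ^ 2 := by
    have := abs_real_inner_le_norm v η
    rw [hv, one_mul] at this
    have := sq_le_sq' (by linarith [abs_nonneg m, (abs_le.1 this).1]) (abs_le.1 this).2
    linarith
  have sqp : ‖r • v + ε • η‖ ^ 2 = (r + ε * m) ^ 2 + ε ^ 2 * (‖η‖ ^ 2 - m ^ 2) := by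
    rw [norm_add_sq_real, norm_smul, norm_smul, inner_smul_left, inner_smul_right, hv, mul_pow,
      mul_pow, Real.norm_eq_abs, Real.norm_eq_abs, sq_abs, sq_abs]
    simp only [conj_trivial]
    rw [← hm]; ring
  have sqm : ‖r • v - ε • η‖ ^ 2 = (r - ε * m) ^ 2 + ε ^ 2 * (‖η‖ ^ 2 - m ^ 2) := by
    rw [norm_sub_sq_real, norm_smul, norm_smul, inner_smul_left, inner_smul_right, hv, mul_pow,
      mul_pow, Real.norm_eq_abs, Real.norm_eq_abs, sq_abs, sq_abs]
    simp only [conj_trivial]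
    rw [← hm]; ring
  have d0 : 0 < r - 2 * ε := by linarith
  have dp : r - 2 * ε ≤ r + ε * m := by nlinarith
  have dm : r - 2 * ε ≤ r - ε * m := by nlinarith
  have hq : 0 ≤ ε ^ 2 * (‖η‖ ^ 2 - m ^ 2) := by positivity
  have key : ∀ A d q : ℝ, ∀ D, 0 < D → D ≤ d → 0 ≤ q → A ^ 2 = d ^ 2 + q →
      A ≤ d + q / D / 2 := by
    intro A d q D hD hDd hq h
    have hqD : q / D * D = q := by field_simp
    have : 0 ≤ q / D := by positivity
    refine le_trans (le_abs_self A) (abs_le_of_sq_le_sq ?_ (by linarith))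
    nlinarith
  have low : ∀ A d q : ℝ, 0 ≤ A → 0 ≤ q → A ^ 2 = d ^ 2 + q → d ≤ A := by
    intro A d q hA hq h
    nlinarith
  refine ⟨?_, ?_⟩
  · have h1 := key _ _ _ _ d0 dp hq sqp
    have h2 := key _ _ _ _ d0 dm hq sqm
    linarith
  · have h1 := low _ _ _ (norm_nonneg _) hq sqp
    have h2 := low _ _ _ (norm_nonneg _) hq sqm
    have h3 := aux_pow s hs0 hs1 r (ε * m) (by linarith) (by
      rw [abs_mul, abs_of_pos hε]; nlinarith)
    have h4 := Real.rpow_le_rpow (by linarith) h1 (by linarith : (0:ℝ) ≤ 1 + s)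
    have h5 := Real.rpow_le_rpow (by linarith) h2 (by linarith : (0:ℝ) ≤ 1 + s)
    rw [mul_pow] at h3
    linarith

theorem aux_mat {n : ℕ} (L : EuclideanSpace ℝ (Fin n) ≃ₗᵢ[ℝ] EuclideanSpace ℝ (Fin n)) :
    ∃ P : Matrix (Fin n) (Fin n) ℝ, P ∈ Matrix.orthogonalGroup (Fin n) ℝ ∧ ∀ ζ, mact P ζ = L ζ := by
  refine ⟨_, L.toMatrix_mem_unitaryGroup (EuclideanSpace.basisFun (Fin n) ℝ)
    (EuclideanSpace.basisFun (Fin n) ℝ), fun ζ => ?_⟩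
  unfold mact
  rw [Matrix.toEuclideanLin_eq_toLin_orthonormal, Matrix.toLin_toMatrix]
  rfl

theorem aux_avg {n : ℕ} (hn : 0 < n) (d c : ℝ) (hc : 0 ≤ c)
    (g₁ g₂ : EuclideanSpace ℝ (Fin n) → ℝ) (hg₁ : Continuous g₁) (hg₂ : Continuous g₂)
    (h : ∀ ζ ∈ unitSlice n hn, g₁ ζ + g₂ ζ + (g₁ (-ζ) + g₂ (-ζ)) ≤ 2 * c) :
    (⨍ ζ in unitSlice n hn, g₁ ζ ∂(μH[d])) + (⨍ ζ in unitSlice n hn, g₂ ζ ∂(μH[d])) ≤ c := by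
  set S := unitSlice n hn with hS
  set μ : Measure (EuclideanSpace ℝ (Fin n)) := μH[d] with hμ
  have hSm : MeasurableSet S := by
    apply MeasurableSet.inter
    · exact (isOpen_lt continuous_norm continuous_const).measurableSet
    · exact (isClosed_eq (by fun_prop) continuous_const).measurableSet
  rw [setAverage_eq, setAverage_eq, ← smul_add, smul_eq_mul]
  rcases eq_or_ne (μ.real S) 0 with h0 | h0
  · rw [h0]; simpa using hc
  have hfin : μ S ≠ ⊤ := by
    intro ht; apply h0; simp [Measure.real, ht]
  have hint : ∀ g : EuclideanSpace ℝ (Fin n) → ℝ, Continuous g → IntegrableOn g S μ := by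
    intro g hg
    obtain ⟨B, hB⟩ := (isCompact_closedBall (0 : EuclideanSpace ℝ (Fin n)) 1).exists_bound_of_continuousOn
      hg.continuousOn
    apply Measure.integrableOn_of_bounded (M := B) hfin hg.aestronglyMeasurable
    refine (ae_restrict_iff' hSm).2 (Filter.Eventually.of_forall fun ζ hζ => hB ζ ?_)
    simpa using hζ.1.le
  have hneg : ∀ g : EuclideanSpace ℝ (Fin n) → ℝ, ∫ ζ in S, g (-ζ) ∂μ = ∫ ζ in S, g ζ ∂μ := by
    intro g
    have hp := (IsometryEquiv.neg (EuclideanSpace ℝ (Fin n))).measurePreserving_hausdorffMeasure d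
    have := hp.setIntegral_preimage_emb
      (IsometryEquiv.neg (EuclideanSpace ℝ (Fin n))).toHomeomorph.measurableEmbedding g S
    rw [← this]
    congr 1
    congr 1
    ext ζ
    simp [hS, unitSlice]
  have hsum : 2 * ((∫ ζ in S, g₁ ζ ∂μ) + ∫ ζ in S, g₂ ζ ∂μ)
      = ∫ ζ in S, (g₁ ζ + g₂ ζ + (g₁ (-ζ) + g₂ (-ζ))) ∂μ := by
    have i1 := hint g₁ hg₁
    have i2 := hint g₂ hg₂
    have i3 := hint (fun ζ => g₁ (-ζ)) (by fun_prop)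
    have i4 := hint (fun ζ => g₂ (-ζ)) (by fun_prop)
    rw [integral_add (f := fun ζ => g₁ ζ + g₂ ζ) (g := fun ζ => g₁ (-ζ) + g₂ (-ζ)) (i1.add i2)
      (i3.add i4), integral_add i1 i2, integral_add i3 i4, hneg g₁, hneg g₂]
    ring
  have hle : ∫ ζ in S, (g₁ ζ + g₂ ζ + (g₁ (-ζ) + g₂ (-ζ))) ∂μ ≤ ∫ ζ in S, (2 * c) ∂μ := by
    apply setIntegral_mono_on (hint _ (by fun_prop)) (hint _ (by fun_prop)) hSm h
  rw [setIntegral_const, smul_eq_mul] at hle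
  have hpos : 0 < μ.real S := lt_of_le_of_ne measureReal_nonneg (Ne.symm h0)
  rw [inv_mul_le_iff₀ hpos]
  linarith

/-- Pairing estimate for the comparison function. -/
theorem aux_fpair {E : Type*} [NormedAddCommGroup E] [InnerProductSpace ℝ E]
    (s ω₀ C M : ℝ) (hs0 : 0 < s) (hs1 : s < 1) (hω : 0 ≤ ω₀) (hC : 0 ≤ C) (hM : 0 ≤ M)
    (x z v p q : E) (r ε : ℝ) (hv : ‖v‖ = 1) (hxz : x - z = r • v)
    (hp : ‖p‖ ≤ 1) (hq : ‖q‖ ≤ 1) (hε : 0 < ε) (hr : 2 * ε < r)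
    (f₁ : E → E → ℝ)
    (hf₁ : ∀ p q : E, f₁ p q = C * (‖p - q‖ - ω₀ * ‖p - q‖ ^ (1 + s)) + M * ‖p + q‖ ^ 2) :
    f₁ (x + ε • p) (z + ε • q) + f₁ (x + ε • (-p)) (z + ε • (-q)) ≤
      2 * f₁ x z + C * (ε ^ 2 * (‖p - q‖ ^ 2 - ⟪v, p - q⟫ ^ 2) / (r - 2 * ε)
        - ω₀ * ((1 + s) * s * (ε ^ 2 * ⟪v, p - q⟫ ^ 2) * r ^ (s - 1))) + 8 * M * ε ^ 2 := by
  have hη : ‖p - q‖ ≤ 2 := (norm_sub_le p q).trans (by linarith)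
  have hpq : ‖p + q‖ ≤ 2 := (norm_add_le p q).trans (by linarith)
  obtain ⟨h1, h2⟩ := aux_pair s hs0 hs1 v (p - q) r ε hv hη hε hr
  have e1 : (x + ε • p) - (z + ε • q) = r • v + ε • (p - q) := by rw [← hxz]; module
  have e2 : (x + ε • (-p)) - (z + ε • (-q)) = r • v - ε • (p - q) := by rw [← hxz]; module
  have e3 : (x + ε • p) + (z + ε • q) = (x + z) + ε • (p + q) := by module
  have e4 : (x + ε • (-p)) + (z + ε • (-q)) = (x + z) - ε • (p + q) := by module
  have e5 : ‖x - z‖ = r := by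
    rw [hxz, norm_smul, hv, Real.norm_eq_abs, abs_of_pos (by linarith)]; ring
  have h3 : ‖(x + z) + ε • (p + q)‖ ^ 2 + ‖(x + z) - ε • (p + q)‖ ^ 2
      ≤ 2 * ‖x + z‖ ^ 2 + 8 * ε ^ 2 := by
    have hpar := parallelogram_law_with_norm ℝ (x + z) (ε • (p + q))
    have : ‖ε • (p + q)‖ ≤ ε * 2 := by
      rw [norm_smul, Real.norm_eq_abs, abs_of_pos hε]; gcongr
    have := norm_nonneg (ε • (p + q))
    nlinarith
  rw [hf₁, hf₁, hf₁ x z, e1, e2, e3, e4, e5]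
  have h4 := mul_le_mul_of_nonneg_left h2 hω
  have h5 := mul_le_mul_of_nonneg_left (add_le_add h1 (neg_le_neg h4)) hC
  have h6 := mul_le_mul_of_nonneg_left h3 hM
  linarith

/-- Final arithmetic. -/
theorem aux_final (s αmin Cα M ω₀ C r ε X Y f a b TA TB TC : ℝ)
    (hs0 : 0 < s) (hα0 : 0 < αmin) (hα1 : αmin ≤ 1) (hs1 : s < 1) (hCα : 0 < Cα) (hM : 0 < M)
    (hω : 1 / 2 ≤ ω₀) (hω2 : Cα + 2 ≤ ω₀ * (3 * αmin * (s * (1 + s))))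
    (hC : 2 < C) (hε : 0 < ε) (hr : 32 * (C * ω₀) * ε ≤ r) (hX : 1 ≤ X) (hY : Y = X * r)
    (hb : αmin ≤ b) (hba : b ≤ a) (ha : a ≤ 1) (hab : a - b ≤ Cα * Y)
    (hA : TA ≤ 2 * f + C * (ε ^ 2 * Y / (r - 2 * ε) - ω₀ * ((1 + s) * s * (ε ^ 2 * 3) * X))
      + 8 * M * ε ^ 2)
    (hB : TB ≤ 2 * f + C * (ε ^ 2 * Y / (r - 2 * ε)) + 8 * M * ε ^ 2)
    (hCc : TC ≤ 2 * f + C * (ε ^ 2 * (Y + 1) / (r - 2 * ε)) + 8 * M * ε ^ 2) :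
    b * TA + (1 - a) * TB + (a - b) * TC - 2 * f ≤ (2 * (4 * M + 1) - C) * X * ε ^ 2 := by
  have hCω : 1 < C * ω₀ := by nlinarith
  have hd : 0 < r - 2 * ε := by nlinarith
  set K := (r - 2 * ε)⁻¹ with hK
  have hK0 : 0 < K := by positivity
  have hKd : K * (r - 2 * ε) = 1 := by rw [hK]; field_simp
  simp only [div_eq_mul_inv, ← hK] at hA hB hCc
  have hb0 : 0 < b := by linarith
  have h1 := mul_le_mul_of_nonneg_left hA hb0.le
  have h2 := mul_le_mul_of_nonneg_left hB (by linarith : 0 ≤ 1 - a)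
  have h3 := mul_le_mul_of_nonneg_left hCc (by linarith : 0 ≤ a - b)
  have hC0 : 0 < C := by linarith
  have hX0 : 0 < X := by linarith
  -- main negative term
  have h4 : Cα + 2 ≤ b * (3 * ω₀ * ((1 + s) * s)) := by
    have : αmin * (3 * ω₀ * ((1 + s) * s)) ≤ b * (3 * ω₀ * ((1 + s) * s)) := by gcongr
    linarith
  have h5 : (C * ε ^ 2 * X) * (Cα + 2) ≤ (C * ε ^ 2 * X) * (b * (3 * ω₀ * ((1 + s) * s))) := by
    gcongr
  have h6 : (C * ε ^ 2 * K) * (a - b) ≤ (C * ε ^ 2 * K) * (Cα * Y) := by gcongr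
  have h7 : M * ε ^ 2 ≤ M * ε ^ 2 * X := by
    have : 0 < M * ε ^ 2 := by positivity
    nlinarith
  -- Cα bound
  have h8 : Cα + 2 ≤ 6 * ω₀ := by
    have : αmin * (s * (1 + s)) ≤ 1 * (1 * (1 + 1)) := by gcongr
    have := mul_le_mul_of_nonneg_left this (by linarith : 0 ≤ ω₀)
    linarith
  have h9 : C * (1 + Cα) * ε ≤ r - 2 * ε := by
    have : C * (1 + Cα) * ε ≤ C * (6 * ω₀) * ε := by gcongr; linarith
    have h9b : ε ≤ C * ω₀ * ε := by
      have := mul_le_mul_of_nonneg_right hCω.le hε.le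
      linarith
    linarith
  have h10 : C * (K * r - 1) * (1 + Cα) ≤ 2 := by
    have e : K * r - 1 = 2 * ε * K := by linarith
    rw [e]
    have h9' := mul_le_mul_of_nonneg_right h9 hK0.le
    linarith
  have h11 := mul_le_mul_of_nonneg_right h10 (by positivity : 0 ≤ X * ε ^ 2)
  subst hY
  linarith

/-- Geometry of the angle condition. -/
theorem aux_geom {E : Type*} [NormedAddCommGroup E] [InnerProductSpace ℝ E]
    (v p q : E) (Y : ℝ) (hY1 : Y ≤ 1) (hv : ‖v‖ = 1) (hp : ‖p‖ = 1) (hq : ‖q‖ = 1)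
    (h : 4 - Y ≤ ⟪v, p - q⟫ ^ 2) :
    ‖p - q‖ ^ 2 - ⟪v, p - q⟫ ^ 2 ≤ Y ∧ 1 - ⟪v, p⟫ ^ 2 ≤ Y ∧ 3 ≤ ‖p - q‖ ^ 2 ∧
      0 ≤ ‖p - q‖ ^ 2 - ⟪v, p - q⟫ ^ 2 ∧ ‖p + q‖ ^ 2 ≤ Y := by
  have h1 := parallelogram_law_with_norm ℝ p q
  rw [hp, hq] at h1
  have h2 : 0 ≤ ‖p - q‖ ^ 2 - ⟪v, p - q⟫ ^ 2 := by
    have := abs_real_inner_le_norm v (p - q)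
    rw [hv, one_mul] at this
    have := sq_le_sq' (by linarith [(abs_le.1 this).1]) (abs_le.1 this).2
    linarith
  have h3 : 0 ≤ ‖p + q‖ * ‖p + q‖ := by positivity
  refine ⟨by nlinarith, ?_, by nlinarith, h2, by nlinarith⟩
  rw [inner_sub_right] at h
  have c1 := abs_real_inner_le_norm v p
  have c2 := abs_real_inner_le_norm v q
  rw [hv, hp] at c1
  rw [hv, hq] at c2
  obtain ⟨c1a, c1b⟩ := abs_le.1 c1
  obtain ⟨c2a, c2b⟩ := abs_le.1 c2
  generalize ⟪v, p⟫ = c at *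
  generalize ⟪v, q⟫ = d at *
  -- 1 - c² ≤ Y; from (c-d)² ≥ 4 - Y
  nlinarith [sq_nonneg (c + d), sq_nonneg (c - d), mul_nonneg (by linarith : 0 ≤ 1 - c) (by linarith : 0 ≤ 1 + c), mul_nonneg (by linarith : 0 ≤ 1 - d) (by linarith : 0 ≤ 1 + d)]

/-- The reflection part. -/
theorem aux_refl {E : Type*} [NormedAddCommGroup E] [InnerProductSpace ℝ E]
    (v p q u : E) (Y : ℝ) (hY0 : 0 ≤ Y) (hY1 : Y ≤ 1) (hv : ‖v‖ = 1) (hp : ‖p‖ = 1) (hq : ‖q‖ = 1)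
    (h : 4 - Y ≤ ⟪v, p - q⟫ ^ 2) (hu : ‖u‖ ≤ 1) (hpu : ⟪p, u⟫ = 0) :
    let η := u - (ℝ ∙ (p - q))ᗮ.reflection u
    ‖η‖ ^ 2 - ⟪v, η⟫ ^ 2 ≤ Y := by
  intro η
  obtain ⟨g1, -, g3, g4, g5⟩ := aux_geom v p q Y hY1 hv hp hq h
  have hη : η = (2 * (⟪p - q, u⟫ / ‖p - q‖ ^ 2)) • (p - q) := by
    simp only [η]
    rw [Submodule.reflection_orthogonal_apply, Submodule.reflection_singleton_apply]
    simp only [RCLike.ofReal_real_eq_id, id]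
    module
  have hi : ⟪p - q, u⟫ ^ 2 ≤ Y := by
    have e : ⟪p - q, u⟫ = -⟪p + q, u⟫ := by
      rw [inner_sub_left, inner_add_left, hpu]; ring
    have c := abs_real_inner_le_norm (p + q) u
    have c' : |⟪p + q, u⟫| ≤ ‖p + q‖ := c.trans (by nlinarith [norm_nonneg (p + q)])
    rw [e, neg_sq, ← sq_abs]
    have := abs_nonneg ⟪p + q, u⟫
    nlinarith
  rw [hη, norm_smul, inner_smul_right, mul_pow, mul_pow, Real.norm_eq_abs, sq_abs, ← mul_sub]
  set H := ‖p - q‖ ^ 2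
  set i := ⟪p - q, u⟫
  have h1 : (2 * (i / H)) ^ 2 ≤ 1 := by
    have : (2 * (i / H)) ^ 2 = 4 * i ^ 2 / H ^ 2 := by ring
    rw [this, div_le_one (by positivity)]
    nlinarith
  nlinarith

set_option maxHeartbeats 2000000 in
/-- Case 1 estimate (Section 3.2): the opponent pulls the points nearly apart. -/
theorem case1_key_estimate
    {n : ℕ} (hn : 2 ≤ n) (s αmin Cα M ω₀ C : ℝ) (N : ℕ)
    (hs0 : 0 < s) (hs1 : s < 1)
    (hαmin0 : 0 < αmin) (hαmin1 : αmin ≤ 1) (hCα : 0 < Cα) (hM : 0 < M)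
    (hω₀ : max (1 / 2) ((Cα + 2) / (3 * αmin * (s * (1 + s)))) ≤ ω₀)
    (hC : 2 * (4 * M + 1) < C)
    (hN40 : 40 ≤ N) (hNC : 2 ^ ((11 : ℝ) / 2) * 10 * C * ω₀ < (N : ℝ))
    (ε : ℝ) (hε : 0 < ε)
    (x z : EuclideanSpace ℝ (Fin n))
    (hlow : (N : ℝ) * ε / 10 < ‖x - z‖)
    (hupp : ‖x - z‖ ≤ (1 / (2 * (1 + s) * ω₀)) ^ (1 / s))
    (v : EuclideanSpace ℝ (Fin n)) (hv : v = ‖x - z‖⁻¹ • (x - z))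
    (f₁ : EuclideanSpace ℝ (Fin n) → EuclideanSpace ℝ (Fin n) → ℝ)
    (hf₁ : ∀ p q : EuclideanSpace ℝ (Fin n),
      f₁ p q = C * (‖p - q‖ - ω₀ * ‖p - q‖ ^ (1 + s)) + M * ‖p + q‖ ^ 2)
    (a b : ℝ) (hb : αmin ≤ b) (hba : b ≤ a) (ha : a ≤ 1)
    (hab : a - b ≤ Cα * ‖x - z‖ ^ s)
    (νx νz : EuclideanSpace ℝ (Fin n)) (hνx : ‖νx‖ = 1) (hνz : ‖νz‖ = 1)
    (hangle : 4 - ‖x - z‖ ^ s ≤ ⟪v, νx - νz⟫ ^ 2) :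
    ∃ P₁ P₂ P₃ P₄ : Matrix (Fin n) (Fin n) ℝ,
      P₁ ∈ Matrix.orthogonalGroup (Fin n) ℝ ∧ P₂ ∈ Matrix.orthogonalGroup (Fin n) ℝ ∧
      P₃ ∈ Matrix.orthogonalGroup (Fin n) ℝ ∧ P₄ ∈ Matrix.orthogonalGroup (Fin n) ℝ ∧
      mact P₁ (e1 n (by omega)) = νx ∧ mact P₂ (e1 n (by omega)) = νz ∧
      mact P₃ (e1 n (by omega)) = -νx ∧ mact P₄ (e1 n (by omega)) = -νz ∧
      ((b * f₁ (x + ε • νx) (z + ε • νz)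
        + (1 - a) * ⨍ ζ in unitSlice n (by omega),
            f₁ (x + ε • mact P₁ ζ) (z + ε • mact P₂ ζ) ∂(μH[((n : ℝ) - 1)])
        + (a - b) * ⨍ ζ in unitSlice n (by omega),
            f₁ (x + ε • νx) (z + ε • mact P₂ ζ) ∂(μH[((n : ℝ) - 1)]))
      + (b * f₁ (x + ε • (-νx)) (z + ε • (-νz))
        + (1 - a) * ⨍ ζ in unitSlice n (by omega),
            f₁ (x + ε • mact P₃ ζ) (z + ε • mact P₄ ζ) ∂(μH[((n : ℝ) - 1)])
        + (a - b) * ⨍ ζ in unitSlice n (by omega),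
            f₁ (x + ε • (-νx)) (z + ε • mact P₄ ζ) ∂(μH[((n : ℝ) - 1)]))
      - 2 * f₁ x z
        ≤ (2 * (4 * M + 1) - C) * ‖x - z‖ ^ (s - 1) * ε ^ 2) ∧
      (2 * (4 * M + 1) - C) * ‖x - z‖ ^ (s - 1) * ε ^ 2 < 0 := by
  have hω1 : 1 / 2 ≤ ω₀ := (le_max_left _ _).trans hω₀
  have hω2 : Cα + 2 ≤ ω₀ * (3 * αmin * (s * (1 + s))) :=
    (div_le_iff₀ (by positivity)).1 ((le_max_right _ _).trans hω₀)
  have hω0 : 0 < ω₀ := by linarith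
  have hC2 : 2 < C := by linarith
  have hC0 : 0 < C := by linarith
  set r := ‖x - z‖ with hrdef
  have h32 : (32 : ℝ) ≤ 2 ^ ((11 : ℝ) / 2) := by
    calc (32 : ℝ) = 2 ^ (5 : ℝ) := by norm_num
      _ ≤ 2 ^ ((11 : ℝ) / 2) := Real.rpow_le_rpow_of_exponent_le (by norm_num) (by norm_num)
  have hCω0 : 0 < C * ω₀ := by positivity
  have hr32 : 32 * (C * ω₀) * ε ≤ r := by
    have h1 : 32 * (C * ω₀) ≤ 2 ^ ((11 : ℝ) / 2) * (C * ω₀) := by gcongr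
    have h2 : 32 * (C * ω₀) * 10 ≤ (N : ℝ) := by linarith
    have h3 := mul_le_mul_of_nonneg_right h2 hε.le
    linarith
  have hCω1 : 1 < C * ω₀ := by nlinarith
  have hr2 : 2 * ε < r := by nlinarith
  have hr0 : 0 < r := by linarith
  have hden : 0 < 2 * (1 + s) * ω₀ := by positivity
  have hden1 : 1 ≤ 2 * (1 + s) * ω₀ := by nlinarith
  have hYb : r ^ s ≤ 1 / (2 * (1 + s) * ω₀) := by
    have h1 := Real.rpow_le_rpow hr0.le hupp hs0.le
    rwa [← Real.rpow_mul (by positivity), one_div_mul_cancel hs0.ne', Real.rpow_one] at h1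
  have hY1 : r ^ s ≤ 1 := hYb.trans (by rw [div_le_one hden]; exact hden1)
  have hY0 : 0 < r ^ s := Real.rpow_pos_of_pos hr0 s
  have hr1 : r ≤ 1 := by
    refine hupp.trans (Real.rpow_le_one (by positivity) ?_ (by positivity))
    rw [div_le_one hden]; exact hden1
  have hX1 : 1 ≤ r ^ (s - 1) := Real.one_le_rpow_of_pos_of_le_one_of_nonpos hr0 hr1 (by linarith)
  have hYX : r ^ s = r ^ (s - 1) * r := by
    rw [Real.rpow_sub_one hr0.ne']; field_simp
  have hvn : ‖v‖ = 1 := by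
    rw [hv, norm_smul, norm_inv, norm_norm, ← hrdef, inv_mul_cancel₀ hr0.ne']
  have hxz : x - z = r • v := by
    rw [hv, smul_smul, mul_inv_cancel₀ hr0.ne', one_smul]
  have hf0 : 0 ≤ f₁ x z := by
    rw [hf₁, ← hrdef, Real.rpow_add hr0, Real.rpow_one]
    have h1 : ω₀ * r ^ s ≤ 1 := by
      rw [le_div_iff₀ hden] at hYb
      nlinarith [mul_pos hω0 hY0]
    have h2 : ω₀ * (r * r ^ s) ≤ r := by nlinarith
    have h3 : 0 ≤ r - ω₀ * (r * r ^ s) := by linarith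
    positivity
  have hKd : 0 < r - 2 * ε := by linarith
  have hn0 : 0 < n := by omega
  obtain ⟨g1, g2, g3, g4, g5⟩ := aux_geom v νx νz (r ^ s) hY1 hvn hνx hνz hangle
  have fp := fun p q hp hq => aux_fpair s ω₀ C M hs0 hs1 hω0.le hC0.le hM.le x z v p q r ε hvn hxz
    hp hq hε hr2 f₁ hf₁
  -- the isometries
  have he1 : ‖e1 n hn0‖ = 1 := by simp [e1]
  let L₁ : EuclideanSpace ℝ (Fin n) ≃ₗᵢ[ℝ] EuclideanSpace ℝ (Fin n) :=
    (ℝ ∙ (e1 n hn0 - νx))ᗮ.reflection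
  have hL₁ : L₁ (e1 n hn0) = νx := Submodule.reflection_sub (by rw [he1, hνx])
  let R : EuclideanSpace ℝ (Fin n) ≃ₗᵢ[ℝ] EuclideanSpace ℝ (Fin n) :=
    (ℝ ∙ (νx - νz))ᗮ.reflection
  have hR : R νx = νz := Submodule.reflection_sub (by rw [hνx, hνz])
  obtain ⟨P₁, hP₁, hP₁a⟩ := aux_mat L₁
  obtain ⟨P₂, hP₂, hP₂a⟩ := aux_mat (L₁.trans R)
  obtain ⟨P₃, hP₃, hP₃a⟩ := aux_mat (L₁.trans (LinearIsometryEquiv.neg ℝ))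
  obtain ⟨P₄, hP₄, hP₄a⟩ := aux_mat ((L₁.trans R).trans (LinearIsometryEquiv.neg ℝ))
  refine ⟨P₁, P₂, P₃, P₄, hP₁, hP₂, hP₃, hP₄, ?_, ?_, ?_, ?_, ?_, ?_⟩
  · rw [hP₁a, hL₁]
  · rw [hP₂a, LinearIsometryEquiv.trans_apply, hL₁, hR]
  · rw [hP₃a, LinearIsometryEquiv.trans_apply, hL₁]; simp
  · rw [hP₄a, LinearIsometryEquiv.trans_apply, LinearIsometryEquiv.trans_apply, hL₁, hR]; simp
  · simp only [hP₁a, hP₂a, hP₃a, hP₄a, LinearIsometryEquiv.trans_apply,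
      LinearIsometryEquiv.coe_neg]
    have hfc : Continuous (fun pq : EuclideanSpace ℝ (Fin n) × EuclideanSpace ℝ (Fin n) =>
        f₁ pq.1 pq.2) := by
      simp only [hf₁]
      have : Continuous (fun pq : EuclideanSpace ℝ (Fin n) × EuclideanSpace ℝ (Fin n) =>
        ‖pq.1 - pq.2‖ ^ (1 + s)) :=
        Continuous.rpow_const (by fun_prop) (fun _ => Or.inr (by linarith))
      fun_prop
    have hfc2 : ∀ A B : EuclideanSpace ℝ (Fin n) → EuclideanSpace ℝ (Fin n), Continuous A →
        Continuous B → Continuous (fun ζ => f₁ (A ζ) (B ζ)) :=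
      fun A B hA hB => hfc.comp (hA.prodMk hB)
    have hL₁c : Continuous L₁ := L₁.continuous
    have hRc : Continuous R := R.continuous
    have hslice : ∀ ζ ∈ unitSlice n hn0, ‖L₁ ζ‖ ≤ 1 ∧ ‖R (L₁ ζ)‖ ≤ 1 ∧ ⟪νx, L₁ ζ⟫ = 0 := by
      intro ζ hζ
      refine ⟨?_, ?_, ?_⟩
      · rw [L₁.norm_map]; exact hζ.1.le
      · rw [R.norm_map, L₁.norm_map]; exact hζ.1.le
      · rw [← hL₁, L₁.inner_map_map]; exact hζ.2
    -- term A
    have hA : f₁ (x + ε • νx) (z + ε • νz) + f₁ (x + ε • (-νx)) (z + ε • (-νz)) ≤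
        2 * f₁ x z + C * (ε ^ 2 * r ^ s / (r - 2 * ε)
          - ω₀ * ((1 + s) * s * (ε ^ 2 * 3) * r ^ (s - 1))) + 8 * M * ε ^ 2 := by
      refine (fp νx νz hνx.le hνz.le).trans ?_
      have : 3 ≤ ⟪v, νx - νz⟫ ^ 2 := by linarith
      gcongr
    have hB0 : ∀ p q : EuclideanSpace ℝ (Fin n), ‖p‖ ≤ 1 → ‖q‖ ≤ 1 →
        f₁ (x + ε • p) (z + ε • q) + f₁ (x + ε • (-p)) (z + ε • (-q)) ≤
        2 * f₁ x z + C * (ε ^ 2 * (‖p - q‖ ^ 2 - ⟪v, p - q⟫ ^ 2) / (r - 2 * ε))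
          + 8 * M * ε ^ 2 := by
      intro p q hp hq
      refine (fp p q hp hq).trans ?_
      have : 0 ≤ ω₀ * ((1 + s) * s * (ε ^ 2 * ⟪v, p - q⟫ ^ 2) * r ^ (s - 1)) := by positivity
      gcongr
      linarith
    have hB := aux_avg hn0 ((n : ℝ) - 1)
      (2 * f₁ x z + C * (ε ^ 2 * r ^ s / (r - 2 * ε)) + 8 * M * ε ^ 2) (by positivity)
      (fun ζ => f₁ (x + ε • L₁ ζ) (z + ε • R (L₁ ζ)))
      (fun ζ => f₁ (x + ε • (-L₁ ζ)) (z + ε • (-R (L₁ ζ))))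
      (hfc2 _ _ (by fun_prop) (by fun_prop)) (hfc2 _ _ (by fun_prop) (by fun_prop)) (by
        intro ζ hζ
        obtain ⟨s1, s2, s3⟩ := hslice ζ hζ
        have h1 := hB0 _ _ s1 s2
        have h2 := aux_refl v νx νz (L₁ ζ) (r ^ s) hY0.le hY1 hvn hνx hνz hangle s1 s3
        simp only [] at h2
        have h3 : C * (ε ^ 2 * (‖L₁ ζ - R (L₁ ζ)‖ ^ 2 - ⟪v, L₁ ζ - R (L₁ ζ)⟫ ^ 2) / (r - 2 * ε))
          ≤ C * (ε ^ 2 * r ^ s / (r - 2 * ε)) := by gcongr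
        simp only [map_neg, neg_neg]
        linarith)
    have hCc := aux_avg hn0 ((n : ℝ) - 1)
      (2 * f₁ x z + C * (ε ^ 2 * (r ^ s + 1) / (r - 2 * ε)) + 8 * M * ε ^ 2) (by positivity)
      (fun ζ => f₁ (x + ε • νx) (z + ε • R (L₁ ζ)))
      (fun ζ => f₁ (x + ε • (-νx)) (z + ε • (-R (L₁ ζ))))
      (hfc2 _ _ (by fun_prop) (by fun_prop)) (hfc2 _ _ (by fun_prop) (by fun_prop)) (by
        intro ζ hζ
        obtain ⟨s1, s2, s3⟩ := hslice ζ hζ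
        have h1 := hB0 νx (R (L₁ ζ)) hνx.le s2
        have h2 := hB0 νx (-R (L₁ ζ)) hνx.le (by rwa [norm_neg])
        simp only [map_neg, neg_neg] at h2 ⊢
        generalize R (L₁ ζ) = q at *
        have h3 : (‖νx - q‖ ^ 2 - ⟪v, νx - q⟫ ^ 2) + (‖νx - -q‖ ^ 2 - ⟪v, νx - -q⟫ ^ 2)
            ≤ 2 * (r ^ s + 1) := by
          rw [sub_neg_eq_add, inner_sub_right, inner_add_right]
          have := parallelogram_law_with_norm ℝ νx q
          rw [hνx] at this
          nlinarith [sq_nonneg ⟪v, q⟫, norm_nonneg q]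
        have h4 : C * (ε ^ 2 * ((‖νx - q‖ ^ 2 - ⟪v, νx - q⟫ ^ 2)
            + (‖νx - -q‖ ^ 2 - ⟪v, νx - -q⟫ ^ 2)) / (r - 2 * ε))
          ≤ C * (ε ^ 2 * (2 * (r ^ s + 1)) / (r - 2 * ε)) := by gcongr
        have h5 : C * (ε ^ 2 * ((‖νx - q‖ ^ 2 - ⟪v, νx - q⟫ ^ 2)
            + (‖νx - -q‖ ^ 2 - ⟪v, νx - -q⟫ ^ 2)) / (r - 2 * ε))
          = C * (ε ^ 2 * (‖νx - q‖ ^ 2 - ⟪v, νx - q⟫ ^ 2) / (r - 2 * ε))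
            + C * (ε ^ 2 * (‖νx - -q‖ ^ 2 - ⟪v, νx - -q⟫ ^ 2) / (r - 2 * ε)) := by ring
        have h6 : C * (ε ^ 2 * (2 * (r ^ s + 1)) / (r - 2 * ε))
          = 2 * (C * (ε ^ 2 * (r ^ s + 1) / (r - 2 * ε))) := by ring
        linarith)
    have hfin := aux_final s αmin Cα M ω₀ C r ε (r ^ (s - 1)) (r ^ s) (f₁ x z) a b _ _ _ hs0 hαmin0
      hαmin1 hs1 hCα hM hω1 hω2 hC2 hε hr32 hX1 hYX hb hba ha hab hA hB hCc
    refine le_trans (le_of_eq ?_) hfin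
    ring
  · have : 0 < r ^ (s - 1) := by linarith
    have h2 : 0 < (C - 2 * (4 * M + 1)) * r ^ (s - 1) * ε ^ 2 := by
      have : 0 < C - 2 * (4 * M + 1) := by linarith
      positivity
    linarith
end
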